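/- arXiv:2012.05888 — 4 statements merged into one kernel-verified Lean document; each statement's English description precedes it below -/
import Mathlib

section
/- Let D ≥ 1, R ≥ 1, M₁ ≥ 0 be integers and let ι_1, …, ι_R be spatial multi-indices with Σ_{r=1}^R |ι_r| = M₁. There exists a constant C = C(D, M₁, R) > 0 such that for all smooth functions v_1, …, v_R : 𝕋^D → ℝ: ‖∂^{ι_1} v_1 ⋯ ∂^{ι_R} v_R‖_{L²} ≤ C Σ_{r=1}^R ‖v_r‖_{Ḣ^{M₁}} ∏_{s ≠ r} ‖v_s‖_{L^∞}. (Paper's Lemma 4.1, product inequality (4.3).) -/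
noncomputable section

open MeasureTheory

/-- `v` is `ℤ^D`-periodic: models a function on the torus `𝕋^D = (ℝ/ℤ)^D`. -/
def TorusFun (D : ℕ) (v : (Fin D → ℝ) → ℝ) : Prop :=
  ∀ (x : Fin D → ℝ) (i : Fin D), v (x + Pi.single i 1) = v x

/-- Coordinate partial derivative `∂_i v`. -/
def pd {D : ℕ} (i : Fin D) (v : (Fin D → ℝ) → ℝ) : (Fin D → ℝ) → ℝ :=
  fun x => fderiv ℝ v x (Pi.single i 1)

/-- Iterated coordinate derivative `∂^ι v` for a spatial multi-index `ι`
(encoded as a list of coordinate directions; `|ι|` is the length of the list). -/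
def pdIter {D : ℕ} : List (Fin D) → ((Fin D → ℝ) → ℝ) → ((Fin D → ℝ) → ℝ)
  | [], v => v
  | i :: l, v => pd i (pdIter l v)

/-- The fundamental domain `[0,1]^D` of `𝕋^D`. -/
def cube (D : ℕ) : Set (Fin D → ℝ) := Set.univ.pi fun _ => Set.Icc (0 : ℝ) 1

/-- Squared `L²(𝕋^D)` norm. -/
def L2sq {D : ℕ} (v : (Fin D → ℝ) → ℝ) : ℝ := ∫ x in cube D, (v x) ^ 2

/-- `L²(𝕋^D)` norm. -/
def L2norm {D : ℕ} (v : (Fin D → ℝ) → ℝ) : ℝ := Real.sqrt (L2sq v)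

/-- Homogeneous Sobolev seminorm `‖v‖_{Ḣ^M}`: the sum ranges over all ordered
spatial multi-indices of length `M`, encoded as functions `Fin M → Fin D`. -/
def HdotNorm {D : ℕ} (M : ℕ) (v : (Fin D → ℝ) → ℝ) : ℝ :=
  Real.sqrt (∑ ι : Fin M → Fin D, L2sq (pdIter (List.ofFn ι) v))

/-- Inhomogeneous Sobolev norm `‖v‖_{H^M}` (sum over all multi-indices `|ι| ≤ M`). -/
def HNorm {D : ℕ} (M : ℕ) (v : (Fin D → ℝ) → ℝ) : ℝ :=
  Real.sqrt (∑ m ∈ Finset.range (M + 1), ∑ ι : Fin m → Fin D, L2sq (pdIter (List.ofFn ι) v))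

/-- `L^∞(𝕋^D)` norm. -/
def LinfNorm {D : ℕ} (v : (Fin D → ℝ) → ℝ) : ℝ := ⨆ x, |v x|

/-- `W^{M,∞}(𝕋^D)` norm (sum over all multi-indices `|ι| ≤ M`). -/
def WinfNorm {D : ℕ} (M : ℕ) (v : (Fin D → ℝ) → ℝ) : ℝ :=
  ∑ m ∈ Finset.range (M + 1), ∑ ι : Fin m → Fin D, LinfNorm (pdIter (List.ofFn ι) v)

theorem sq_logconvex_step (K : ℝ) (hK : 1 ≤ K) (j : ℕ) : ∃ C : ℝ, 1 ≤ C ∧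
    ∀ a : ℕ → ℝ, (∀ i, 0 ≤ a i) → (∀ i < j, a (i + 1) ^ 2 ≤ K * (a i * a (i + 2))) →
      a j ^ (j + 1) ≤ C * (a 0 * a (j + 1) ^ j) := by
  induction j with
  | zero => exact ⟨1, le_rfl, fun a _ _ => by simp⟩
  | succ j ih =>
    obtain ⟨C, hC, h⟩ := ih
    have hKC : 1 ≤ K ^ (j + 1) * C := one_le_mul_of_one_le_of_one_le (one_le_pow₀ hK) hC
    refine ⟨K ^ (j + 1) * C, hKC, fun a ha hc => ?_⟩
    have h1 := h a ha fun i hi => hc i (by omega)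
    have h2 := hc j (by omega)
    rcases (ha (j + 1)).eq_or_lt with h0 | h0
    · rw [← h0, zero_pow (by omega)]
      have := ha 0
      have := ha (j + 1 + 1)
      positivity
    · refine le_of_mul_le_mul_right ?_ (pow_pos h0 j)
      calc a (j + 1) ^ (j + 1 + 1) * a (j + 1) ^ j = (a (j + 1) ^ 2) ^ (j + 1) := by ring
        _ ≤ (K * (a j * a (j + 2))) ^ (j + 1) := pow_le_pow_left₀ (by positivity) h2 _
        _ = K ^ (j + 1) * a (j + 2) ^ (j + 1) * a j ^ (j + 1) := by ring
        _ ≤ K ^ (j + 1) * a (j + 2) ^ (j + 1) * (C * (a 0 * a (j + 1) ^ j)) := by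
          refine mul_le_mul_of_nonneg_left h1 ?_
          have := ha (j + 2)
          positivity
        _ = _ := by ring

theorem sq_logconvex_interpolation (K : ℝ) (hK : 1 ≤ K) (k : ℕ) : ∀ j : ℕ, ∃ C : ℝ, 1 ≤ C ∧
    ∀ a : ℕ → ℝ, (∀ i, 0 ≤ a i) →
      (∀ i, i + 1 < j + k → a (i + 1) ^ 2 ≤ K * (a i * a (i + 2))) →
      a j ^ (j + k) ≤ C * (a 0 ^ k * a (j + k) ^ j) := by
  induction k with
  | zero => exact fun j => ⟨1, le_rfl, fun a _ _ => by simp⟩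
  | succ k ih =>
    intro j
    obtain ⟨C₁, hC₁, h₁⟩ := sq_logconvex_step K hK j
    obtain ⟨C₂, hC₂, h₂⟩ := ih (j + 1)
    have hC : 1 ≤ C₁ ^ (j + 1 + k) * C₂ ^ j :=
      one_le_mul_of_one_le_of_one_le (one_le_pow₀ hC₁) (one_le_pow₀ hC₂)
    refine ⟨_, hC, fun a ha hc => ?_⟩
    have e : j + 1 + k = j + (k + 1) := by omega
    have h3 := h₁ a ha fun i hi => hc i (by omega)
    have h4 := h₂ a ha fun i hi => hc i (by omega)
    have := ha 0
    have := ha j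
    have := ha (j + 1)
    have := ha (j + 1 + k)
    rw [← e]
    refine le_of_pow_le_pow_left₀ (n := j + 1) (by omega) (by positivity) ?_
    calc (a j ^ (j + 1 + k)) ^ (j + 1) = (a j ^ (j + 1)) ^ (j + 1 + k) := by
          rw [← pow_mul, ← pow_mul, mul_comm]
      _ ≤ (C₁ * (a 0 * a (j + 1) ^ j)) ^ (j + 1 + k) := pow_le_pow_left₀ (by positivity) h3 _
      _ = C₁ ^ (j + 1 + k) * a 0 ^ (j + 1 + k) * (a (j + 1) ^ (j + 1 + k)) ^ j := by
        rw [mul_pow, mul_pow, ← pow_mul, ← pow_mul, mul_comm j, mul_assoc]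
      _ ≤ C₁ ^ (j + 1 + k) * a 0 ^ (j + 1 + k) *
          (C₂ * (a 0 ^ k * a (j + 1 + k) ^ (j + 1))) ^ j := by
        gcongr
      _ = (C₁ ^ (j + 1 + k) * C₂ ^ j) * (a 0 ^ (k + 1) * a (j + 1 + k) ^ j) ^ (j + 1) := by
        ring
      _ ≤ (C₁ ^ (j + 1 + k) * C₂ ^ j) ^ (j + 1) *
          (a 0 ^ (k + 1) * a (j + 1 + k) ^ j) ^ (j + 1) := by
        refine mul_le_mul_of_nonneg_right (le_self_pow₀ hC (by omega)) (by positivity)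
      _ = _ := by rw [← mul_pow]

theorem exists_interpolation_const (K : ℝ) (hK : 1 ≤ K) (M : ℕ) : ∃ C : ℝ, 1 ≤ C ∧
    ∀ j ≤ M, ∀ a : ℕ → ℝ, (∀ i, 0 ≤ a i) →
      (∀ i, i + 1 < M → a (i + 1) ^ 2 ≤ K * (a i * a (i + 2))) →
      a j ^ M ≤ C * (a 0 ^ (M - j) * a M ^ j) := by
  choose C hC h using fun j => sq_logconvex_interpolation K hK (M - j) j
  have hle : ∀ j ≤ M, C j ≤ ∑ i ∈ Finset.range (M + 1), C i := fun j hj =>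
    Finset.single_le_sum (f := C) (fun i _ => zero_le_one.trans (hC i))
      (Finset.mem_range.2 (by omega))
  refine ⟨∑ i ∈ Finset.range (M + 1), C i, (hC 0).trans (hle 0 M.zero_le), ?_⟩
  intro j hj a ha hc
  have h1 := h j a ha
  rw [Nat.add_sub_cancel' hj] at h1
  refine (h1 hc).trans (mul_le_mul_of_nonneg_right (hle j hj) ?_)
  have := ha 0
  have := ha M
  positivity

theorem TorusFun.pd {D : ℕ} {v : (Fin D → ℝ) → ℝ} (hv : TorusFun D v) (i : Fin D) :
    TorusFun D (pd i v) := by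
  intro x j
  have h : (fun y => v (y + Pi.single j 1)) = v := funext fun y => hv y j
  change fderiv ℝ v (x + Pi.single j 1) _ = fderiv ℝ v x _
  rw [← fderiv_comp_add_right, h]

theorem contDiff_pd {D : ℕ} {v : (Fin D → ℝ) → ℝ} (hv : ContDiff ℝ (⊤ : ℕ∞) v) (i : Fin D) :
    ContDiff ℝ (⊤ : ℕ∞) (pd i v) :=
  (hv.fderiv_right (m := (⊤ : ℕ∞)) (by simp)).clm_apply contDiff_const

theorem TorusFun.pdIter {D : ℕ} {v : (Fin D → ℝ) → ℝ} (hv : TorusFun D v) (l : List (Fin D)) :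
    TorusFun D (pdIter l v) := by
  induction l with
  | nil => exact hv
  | cons i l ih => exact ih.pd i

theorem contDiff_pdIter {D : ℕ} {v : (Fin D → ℝ) → ℝ} (hv : ContDiff ℝ (⊤ : ℕ∞) v)
    (l : List (Fin D)) : ContDiff ℝ (⊤ : ℕ∞) (pdIter l v) := by
  induction l with
  | nil => exact hv
  | cons i l ih => exact contDiff_pd ih i

theorem cube_eq_Icc (D : ℕ) : cube D = Set.Icc 0 1 := Set.pi_univ_Icc _ _

theorem isCompact_cube (D : ℕ) : IsCompact (cube D) := isCompact_univ_pi fun _ => isCompact_Icc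

theorem TorusFun.exists_mem_cube {D : ℕ} {v : (Fin D → ℝ) → ℝ} (hv : TorusFun D v)
    (x : Fin D → ℝ) : ∃ y ∈ cube D, v y = v x := by
  have h : ∀ s : Finset (Fin D), v (x - ∑ i ∈ s, ⌊x i⌋ • Pi.single i (1 : ℝ)) = v x := by
    intro s
    induction s using Finset.induction_on with
    | empty => simp
    | insert i s hi ih =>
      have hp : Function.Periodic v (Pi.single i (1 : ℝ)) := fun y => hv y i
      rw [Finset.sum_insert hi, add_comm, ← sub_sub, hp.sub_zsmul_eq, ih]
  refine ⟨_, ?_, h Finset.univ⟩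
  intro i _
  have e : (x - ∑ j, ⌊x j⌋ • Pi.single j (1 : ℝ)) i = Int.fract (x i) := by
    simp [Finset.sum_apply, Pi.single_apply]
  rw [e]
  exact ⟨Int.fract_nonneg _, (Int.fract_lt_one _).le⟩

theorem TorusFun.abs_le_LinfNorm {D : ℕ} {v : (Fin D → ℝ) → ℝ} (hv : TorusFun D v)
    (hc : Continuous v) (x : Fin D → ℝ) : |v x| ≤ LinfNorm v := by
  refine le_ciSup (f := fun x => |v x|) ?_ x
  obtain ⟨B, hB⟩ := (isCompact_cube D).bddAbove_image hc.abs.continuousOn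
  refine ⟨B, ?_⟩
  rintro _ ⟨y, rfl⟩
  obtain ⟨z, hz, hzy⟩ := hv.exists_mem_cube y
  simp only [← hzy]
  exact hB ⟨z, hz, rfl⟩

theorem LinfNorm_nonneg {D : ℕ} (v : (Fin D → ℝ) → ℝ) : 0 ≤ LinfNorm v :=
  Real.iSup_nonneg fun _ => abs_nonneg _

theorem integrableOn_cube {D : ℕ} {f : (Fin D → ℝ) → ℝ} (hf : Continuous f) :
    IntegrableOn f (cube D) :=
  hf.continuousOn.integrableOn_compact (isCompact_cube D)

/-- The integral of a partial derivative of a periodic function vanishes. -/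
theorem TorusFun.integral_fderiv_eq_zero {D : ℕ} {F : (Fin D → ℝ) → ℝ} (hF : TorusFun D F)
    {F' : (Fin D → ℝ) → (Fin D → ℝ) →L[ℝ] ℝ} (hd : ∀ x, HasFDerivAt F (F' x) x) (i : Fin D)
    (hc : Continuous fun x => F' x (Pi.single i 1)) :
    ∫ x in cube D, F' x (Pi.single i 1) = 0 := by
  obtain _ | n := D
  · exact i.elim0
  have hsum : ∀ x, ∑ j, (if j = i then F' x else 0) (Pi.single j 1) = F' x (Pi.single i 1) := by
    intro x
    rw [Finset.sum_eq_single i (fun j _ hj => by simp [hj]) (by simp)]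
    simp
  have h := integral_divergence_of_hasFDerivAt_off_countable' (0 : Fin (n + 1) → ℝ) 1
    zero_le_one (fun j => if j = i then F else 0) (fun j x => if j = i then F' x else 0) ∅
    Set.countable_empty
    (fun j => by
      split_ifs
      · exact (continuous_iff_continuousAt.2 fun x => (hd x).continuousAt).continuousOn
      · exact continuousOn_const)
    (fun x _ j => by
      split_ifs
      · exact hd x
      · exact hasFDerivAt_const 0 x)
    (by
      simp only [hsum, ← cube_eq_Icc]
      exact integrableOn_cube hc)
  simp only [hsum, ← cube_eq_Icc] at h
  rw [h]
  refine Finset.sum_eq_zero fun j _ => ?_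
  by_cases hj : j = i
  · subst hj
    have e : ∀ x : Fin n → ℝ, F (j.insertNth ((1 : Fin (n + 1) → ℝ) j) x) =
        F (j.insertNth ((0 : Fin (n + 1) → ℝ) j) x) := by
      intro x
      refine Eq.trans ?_ (hF _ j)
      congr 1
      ext k
      rcases Fin.eq_self_or_eq_succAbove j k with rfl | ⟨m, rfl⟩ <;> simp
    simp only [if_true, e, sub_self]
  · simp [hj]

theorem hasDerivAt_abs_rpow_mul_self {q : ℝ} (hq : 0 < q) (x : ℝ) :
    HasDerivAt (fun y : ℝ => |y| ^ q * y) ((q + 1) * |x| ^ q) x := by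
  rcases eq_or_ne x 0 with rfl | hx
  · rw [hasDerivAt_iff_tendsto_slope]
    have hc : Continuous fun y : ℝ => |y| ^ q := continuous_abs.rpow_const fun _ => Or.inr hq.le
    have h := (hc.tendsto 0).mono_left (nhdsWithin_le_nhds (s := {0}ᶜ))
    simp only [abs_zero, Real.zero_rpow hq.ne', mul_zero] at h ⊢
    refine h.congr' ?_
    filter_upwards [self_mem_nhdsWithin] with y hy
    have : y ≠ 0 := hy
    simp [slope_def_field, this]
  · have h := ((hasDerivAt_abs hx).rpow_const (p := q) (Or.inl (abs_ne_zero.2 hx))).mul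
      (hasDerivAt_id x)
    refine h.congr_deriv ?_
    have e : |x| ^ q = |x| ^ (q - 1) * |x| := by
      rw [← Real.rpow_add_one (abs_ne_zero.2 hx), sub_add_cancel]
    simp only [id, mul_one]
    rw [e]
    have h2 : (SignType.sign x : ℝ) * x = |x| := sign_mul_self x
    linear_combination (q * |x| ^ (q - 1)) * h2

/-- The norm of `L^{2/θ}(𝕋^D)`, with the convention `2/0 = ∞`. -/
def LthetaNorm {D : ℕ} (θ : ℝ) (g : (Fin D → ℝ) → ℝ) : ℝ :=
  (if θ = 0 then LinfNorm g else 1) * (∫ x in cube D, |g x| ^ (2 / θ)) ^ (θ / 2)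

theorem LthetaNorm_nonneg {D : ℕ} (θ : ℝ) (g : (Fin D → ℝ) → ℝ) : 0 ≤ LthetaNorm θ g := by
  have := LinfNorm_nonneg g
  have : 0 ≤ ∫ x in cube D, |g x| ^ (2 / θ) := integral_nonneg fun x => by positivity
  unfold LthetaNorm
  positivity

theorem LthetaNorm_zero {D : ℕ} (g : (Fin D → ℝ) → ℝ) : LthetaNorm 0 g = LinfNorm g := by
  simp [LthetaNorm]

theorem LthetaNorm_one {D : ℕ} (g : (Fin D → ℝ) → ℝ) : LthetaNorm 1 g = L2norm g := by
  simp [LthetaNorm, L2norm, L2sq, Real.sqrt_eq_rpow]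

theorem integral_prod_rpow_le {D : ℕ} {κ : Type*} (s : Finset κ) {h : κ → (Fin D → ℝ) → ℝ}
    (hc : ∀ i ∈ s, Continuous (h i)) (h0 : ∀ i ∈ s, ∀ x, 0 ≤ h i x) {w : κ → ℝ}
    (hw : ∀ i ∈ s, 0 ≤ w i) (hsum : ∑ i ∈ s, w i = 1) :
    ∫ x in cube D, ∏ i ∈ s, h i x ^ w i ≤ ∏ i ∈ s, (∫ x in cube D, h i x) ^ w i := by
  have hI : ∀ i ∈ s, 0 ≤ ∫ x in cube D, h i x := fun i hi => integral_nonneg (h0 i hi)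
  have hp : ∀ x, 0 ≤ ∏ i ∈ s, h i x ^ w i := fun x =>
    Finset.prod_nonneg fun i hi => Real.rpow_nonneg (h0 i hi x) _
  have hcp : Continuous fun x => ∏ i ∈ s, h i x ^ w i :=
    continuous_finsetProd s fun i hi => (hc i hi).rpow_const fun _ => Or.inr (hw i hi)
  rw [← ENNReal.ofReal_le_ofReal_iff
    (Finset.prod_nonneg fun i hi => Real.rpow_nonneg (hI i hi) _),
    ofReal_integral_eq_lintegral_ofReal (integrableOn_cube hcp) (ae_of_all _ hp),
    ENNReal.ofReal_prod_of_nonneg fun i hi => Real.rpow_nonneg (hI i hi) _]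
  have e1 : ∀ x, ENNReal.ofReal (∏ i ∈ s, h i x ^ w i) =
      ∏ i ∈ s, ENNReal.ofReal (h i x) ^ w i := by
    intro x
    rw [ENNReal.ofReal_prod_of_nonneg fun i hi => Real.rpow_nonneg (h0 i hi x) _]
    exact Finset.prod_congr rfl fun i hi =>
      (ENNReal.ofReal_rpow_of_nonneg (h0 i hi x) (hw i hi)).symm
  have e2 : ∀ i ∈ s, ENNReal.ofReal ((∫ x in cube D, h i x) ^ w i) =
      (∫⁻ x in cube D, ENNReal.ofReal (h i x)) ^ w i := by
    intro i hi
    rw [← ENNReal.ofReal_rpow_of_nonneg (hI i hi) (hw i hi),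
      ofReal_integral_eq_lintegral_ofReal (integrableOn_cube (hc i hi)) (ae_of_all _ (h0 i hi))]
  simp only [e1]
  rw [Finset.prod_congr rfl e2]
  exact ENNReal.lintegral_prod_norm_pow_le s
    (fun i hi => (hc i hi).measurable.ennreal_ofReal.aemeasurable) hsum hw

/-- Hölder's inequality for the norms `LthetaNorm`. -/
theorem integral_prod_abs_rpow_le {D : ℕ} {κ : Type*} (s : Finset κ)
    {g : κ → (Fin D → ℝ) → ℝ} (hc : ∀ i ∈ s, Continuous (g i)) (hg : ∀ i ∈ s, TorusFun D (g i))
    {θ a : κ → ℝ} (hθ : ∀ i ∈ s, 0 ≤ θ i) (ha : ∀ i ∈ s, 0 ≤ a i)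
    (hsum : ∑ i ∈ s, a i * θ i = 2) :
    ∫ x in cube D, ∏ i ∈ s, |g i x| ^ a i ≤ ∏ i ∈ s, LthetaNorm (θ i) (g i) ^ a i := by
  set c : κ → ℝ := fun i => if θ i = 0 then LinfNorm (g i) else 1 with hcdef
  have hc0 : ∀ i, 0 ≤ c i := fun i => by
    have := LinfNorm_nonneg (g i)
    simp only [hcdef]
    positivity
  have hcont : ∀ i ∈ s, Continuous fun x => |g i x| ^ (2 / θ i) := fun i hi =>
    (hc i hi).abs.rpow_const fun _ => Or.inr (div_nonneg zero_le_two (hθ i hi))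
  have hw : ∀ i ∈ s, 0 ≤ a i * θ i / 2 := fun i hi =>
    div_nonneg (mul_nonneg (ha i hi) (hθ i hi)) zero_le_two
  have hpt : ∀ x, ∏ i ∈ s, |g i x| ^ a i ≤
      (∏ i ∈ s, c i ^ a i) * ∏ i ∈ s, (|g i x| ^ (2 / θ i)) ^ (a i * θ i / 2) := by
    intro x
    rw [← Finset.prod_mul_distrib]
    refine Finset.prod_le_prod (fun i _ => by positivity) fun i hi => ?_
    by_cases h : θ i = 0
    · simp only [hcdef, h, if_true, mul_zero, zero_div, Real.rpow_zero, mul_one]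
      exact Real.rpow_le_rpow (abs_nonneg _) ((hg i hi).abs_le_LinfNorm (hc i hi) x) (ha i hi)
    · simp only [hcdef, h, if_false, Real.one_rpow, one_mul]
      rw [← Real.rpow_mul (abs_nonneg _)]
      refine le_of_eq ?_
      congr 1
      field_simp
  calc ∫ x in cube D, ∏ i ∈ s, |g i x| ^ a i
      ≤ ∫ x in cube D, (∏ i ∈ s, c i ^ a i) *
          ∏ i ∈ s, (|g i x| ^ (2 / θ i)) ^ (a i * θ i / 2) := by
        refine integral_mono (integrableOn_cube ?_) (integrableOn_cube ?_) hpt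
        · exact continuous_finsetProd s fun i hi =>
            (hc i hi).abs.rpow_const fun _ => Or.inr (ha i hi)
        · exact continuous_const.mul (continuous_finsetProd s fun i hi =>
            (hcont i hi).rpow_const fun _ => Or.inr (hw i hi))
    _ ≤ (∏ i ∈ s, c i ^ a i) *
          ∏ i ∈ s, (∫ x in cube D, |g i x| ^ (2 / θ i)) ^ (a i * θ i / 2) := by
        rw [integral_const_mul]
        refine mul_le_mul_of_nonneg_left ?_
          (Finset.prod_nonneg fun i _ => Real.rpow_nonneg (hc0 i) _)
        refine integral_prod_rpow_le s hcont (fun i _ x => by positivity) hw ?_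
        rw [← Finset.sum_div, hsum, div_self two_ne_zero]
    _ = _ := by
        rw [← Finset.prod_mul_distrib]
        refine Finset.prod_congr rfl fun i _ => ?_
        have hI : 0 ≤ ∫ x in cube D, |g i x| ^ (2 / θ i) :=
          integral_nonneg fun x => by positivity
        rw [LthetaNorm, Real.mul_rpow (hc0 i) (Real.rpow_nonneg hI _), ← Real.rpow_mul hI]
        congr 2
        ring

theorem LthetaNorm_rpow {D : ℕ} {θ : ℝ} (hθ : θ ≠ 0) (g : (Fin D → ℝ) → ℝ) :
    LthetaNorm θ g ^ (2 / θ) = ∫ x in cube D, |g x| ^ (2 / θ) := by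
  have hI : 0 ≤ ∫ x in cube D, |g x| ^ (2 / θ) := integral_nonneg fun x => by positivity
  rw [LthetaNorm, if_neg hθ, one_mul, ← Real.rpow_mul hI]
  have : θ / 2 * (2 / θ) = 1 := by field_simp
  rw [this, Real.rpow_one]

/-- Integration by parts for `∫ |∂_i u|^{q+2}`. -/
theorem integral_abs_pd_rpow {D : ℕ} {u : (Fin D → ℝ) → ℝ} (hu : ContDiff ℝ (⊤ : ℕ∞) u)
    (hp : TorusFun D u) (i : Fin D) {q : ℝ} (hq : 0 < q) :
    ∫ x in cube D, |pd i u x| ^ (q + 2) =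
      -((q + 1) * ∫ x in cube D, u x * (|pd i u x| ^ q * pd i (pd i u) x)) := by
  have hg := contDiff_pd hu i
  have hcu := hu.continuous
  have hcg := hg.continuous
  have hcw := (contDiff_pd hg i).continuous
  have hcq : Continuous fun x => |pd i u x| ^ q := hcg.abs.rpow_const fun _ => Or.inr hq.le
  have hd : ∀ x, HasFDerivAt (fun x => u x * (|pd i u x| ^ q * pd i u x))
      (u x • ((q + 1) * |pd i u x| ^ q) • fderiv ℝ (pd i u) x +
        (|pd i u x| ^ q * pd i u x) • fderiv ℝ u x) x := fun x =>
    ((hu.differentiable (by simp)) x).hasFDerivAt.mul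
      ((hasDerivAt_abs_rpow_mul_self hq _).comp_hasFDerivAt x
        ((hg.differentiable (by simp)) x).hasFDerivAt)
  have hF : TorusFun D fun x => u x * (|pd i u x| ^ q * pd i u x) := fun x j => by
    simp only [hp x j, hp.pd i x j]
  have he : ∀ x, (u x • ((q + 1) * |pd i u x| ^ q) • fderiv ℝ (pd i u) x +
        (|pd i u x| ^ q * pd i u x) • fderiv ℝ u x) (Pi.single i 1) =
      (q + 1) * (u x * (|pd i u x| ^ q * pd i (pd i u) x)) + |pd i u x| ^ (q + 2) := by
    intro x
    have e1 : |pd i u x| ^ (q + 2) = |pd i u x| ^ q * pd i u x * pd i u x := by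
      rw [Real.rpow_add_of_nonneg (abs_nonneg _) hq.le zero_le_two, Real.rpow_two, sq_abs]
      ring
    rw [e1]
    change u x * ((q + 1) * |pd i u x| ^ q * pd i (pd i u) x) +
      |pd i u x| ^ q * pd i u x * pd i u x = _
    ring
  have hc1 : Continuous fun x => (q + 1) * (u x * (|pd i u x| ^ q * pd i (pd i u) x)) := by
    fun_prop
  have hc2 : Continuous fun x => |pd i u x| ^ (q + 2) :=
    hcg.abs.rpow_const fun _ => Or.inr (by positivity)
  have h := hF.integral_fderiv_eq_zero hd i (by
    simp only [he]
    exact hc1.add hc2)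
  simp only [he] at h
  rw [integral_add (integrableOn_cube hc1) (integrableOn_cube hc2), integral_const_mul] at h
  linarith

/-- Gagliardo–Nirenberg inequality for one derivative between zero and two. -/
theorem sq_LthetaNorm_pd_le {D : ℕ} {u : (Fin D → ℝ) → ℝ} (hu : ContDiff ℝ (⊤ : ℕ∞) u)
    (hp : TorusFun D u) (i : Fin D) {θ₀ θ θ₂ : ℝ} (h₀ : 0 ≤ θ₀) (hθ : 0 < θ) (hθ1 : θ < 1)
    (h₂ : 0 ≤ θ₂) (hsum : θ₀ + θ₂ = 2 * θ) :
    LthetaNorm θ (pd i u) ^ 2 ≤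
      (2 / θ - 1) * (LthetaNorm θ₀ u * LthetaNorm θ₂ (pd i (pd i u))) := by
  have hg := contDiff_pd hu i
  have hw := contDiff_pd hg i
  have hN0 := LthetaNorm_nonneg θ₀ u
  have hN2 := LthetaNorm_nonneg θ₂ (pd i (pd i u))
  have hp2 : 2 < 2 / θ := by rw [lt_div_iff₀ hθ]; linarith
  have hq : 0 < 2 / θ - 2 := by linarith
  have hI := integral_abs_pd_rpow hu hp i hq
  rw [sub_add_cancel, ← LthetaNorm_rpow hθ.ne'] at hI
  have hH := integral_prod_abs_rpow_le (Finset.univ : Finset (Fin 3))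
    (g := ![u, pd i u, pd i (pd i u)]) (θ := ![θ₀, θ, θ₂]) (a := ![1, 2 / θ - 2, 1])
    (by simp [Fin.forall_fin_succ, hu.continuous, hg.continuous, hw.continuous])
    (by simp [Fin.forall_fin_succ, hp, hp.pd i, (hp.pd i).pd i])
    (by simp [Fin.forall_fin_succ, h₀, hθ.le, h₂])
    (by simp [Fin.forall_fin_succ, hp2.le])
    (by
      simp [Fin.sum_univ_three]
      field_simp
      linarith)
  simp only [Fin.prod_univ_three, Matrix.cons_val, Real.rpow_one] at hH
  have hneg : -∫ x in cube D, u x * (|pd i u x| ^ (2 / θ - 2) * pd i (pd i u) x) ≤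
      ∫ x in cube D, |u x| * |pd i u x| ^ (2 / θ - 2) * |pd i (pd i u) x| := by
    refine (neg_le_abs _).trans (abs_integral_le_integral_abs.trans (le_of_eq ?_))
    congr 1
    ext x
    rw [abs_mul, abs_mul, abs_of_nonneg (Real.rpow_nonneg (abs_nonneg _) _), mul_assoc]
  rcases (LthetaNorm_nonneg θ (pd i u)).eq_or_lt with h | h
  · rw [← h, zero_pow two_ne_zero]
    have : 0 ≤ 2 / θ - 1 := by linarith
    positivity
  · have hpos := Real.rpow_pos_of_pos h (2 / θ - 2)
    refine le_of_mul_le_mul_right ?_ hpos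
    have e : LthetaNorm θ (pd i u) ^ 2 * LthetaNorm θ (pd i u) ^ (2 / θ - 2) =
        LthetaNorm θ (pd i u) ^ (2 / θ) := by
      rw [← Real.rpow_two, ← Real.rpow_add h]
      congr 1
      ring
    rw [e, hI]
    have := mul_le_mul_of_nonneg_left (hneg.trans hH) (show 0 ≤ 2 / θ - 2 + 1 by linarith)
    linarith

/-- The largest `L^{2M/j}` norm of a derivative of order `j`. -/
def maxDerivNorm {D : ℕ} (M : ℕ) (v : (Fin D → ℝ) → ℝ) (j : ℕ) : ℝ :=
  ⨆ ι : Fin j → Fin D, LthetaNorm ((j : ℝ) / M) (pdIter (List.ofFn ι) v)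

theorem maxDerivNorm_nonneg {D : ℕ} (M : ℕ) (v : (Fin D → ℝ) → ℝ) (j : ℕ) :
    0 ≤ maxDerivNorm M v j :=
  Real.iSup_nonneg fun _ => LthetaNorm_nonneg _ _

theorem LthetaNorm_le_maxDerivNorm {D : ℕ} (M : ℕ) (v : (Fin D → ℝ) → ℝ) (l : List (Fin D)) :
    LthetaNorm ((l.length : ℝ) / M) (pdIter l v) ≤ maxDerivNorm M v l.length := by
  have h := Finite.le_ciSup (fun ι : Fin l.length → Fin D =>
    LthetaNorm ((l.length : ℝ) / M) (pdIter (List.ofFn ι) v)) l.get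
  rwa [List.ofFn_get] at h

theorem maxDerivNorm_zero {D : ℕ} (M : ℕ) (v : (Fin D → ℝ) → ℝ) :
    maxDerivNorm M v 0 = LinfNorm v := by
  simp [maxDerivNorm, LthetaNorm_zero, pdIter]

theorem maxDerivNorm_self_le {D M : ℕ} (hM : M ≠ 0) (v : (Fin D → ℝ) → ℝ) :
    maxDerivNorm M v M ≤ HdotNorm M v := by
  refine Real.iSup_le (fun ι => ?_) (Real.sqrt_nonneg _)
  rw [div_self (Nat.cast_ne_zero.2 hM), LthetaNorm_one]
  refine Real.sqrt_le_sqrt ?_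
  exact Finset.single_le_sum (f := fun ι : Fin M → Fin D => L2sq (pdIter (List.ofFn ι) v))
    (fun ι _ => integral_nonneg fun x => sq_nonneg _) (Finset.mem_univ ι)

theorem sq_maxDerivNorm_le {D M : ℕ} {v : (Fin D → ℝ) → ℝ}
    (hv : ContDiff ℝ (⊤ : ℕ∞) v) (hp : TorusFun D v) {j : ℕ} (hj : j + 1 < M) :
    maxDerivNorm M v (j + 1) ^ 2 ≤
      2 * M * (maxDerivNorm M v j * maxDerivNorm M v (j + 2)) := by
  have hM : (0 : ℝ) < M := by exact_mod_cast (by omega : 0 < M)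
  have h0 := maxDerivNorm_nonneg M v j
  have h2 := maxDerivNorm_nonneg M v (j + 2)
  rcases isEmpty_or_nonempty (Fin (j + 1) → Fin D) with he | he
  · rw [maxDerivNorm, Real.iSup_of_isEmpty, zero_pow two_ne_zero]
    positivity
  obtain ⟨ι, hι⟩ := exists_eq_ciSup_of_finite
    (f := fun ι : Fin (j + 1) → Fin D => LthetaNorm (((j + 1 : ℕ) : ℝ) / M)
      (pdIter (List.ofFn ι) v))
  rw [maxDerivNorm, ← hι]
  set l := List.ofFn fun k : Fin j => ι k.succ with hl
  have hlen : l.length = j := by simp [hl]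
  have e1 : List.ofFn ι = ι 0 :: l := List.ofFn_succ
  have a0 := LthetaNorm_le_maxDerivNorm M v l
  have a2 := LthetaNorm_le_maxDerivNorm M v (ι 0 :: ι 0 :: l)
  rw [hlen] at a0
  simp only [List.length_cons, hlen] at a2
  have hlt : ((j + 1 : ℕ) : ℝ) / M < 1 := by
    rw [div_lt_one hM]
    exact_mod_cast hj
  have hpos : 0 < ((j + 1 : ℕ) : ℝ) / M := by positivity
  have key := sq_LthetaNorm_pd_le (contDiff_pdIter hv l) (hp.pdIter l) (ι 0)
    (θ₀ := (j : ℝ) / M) (θ := ((j + 1 : ℕ) : ℝ) / M) (θ₂ := ((j + 1 + 1 : ℕ) : ℝ) / M)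
    (by positivity) hpos hlt (by positivity) (by push_cast; ring)
  rw [e1]
  refine key.trans (mul_le_mul ?_ (mul_le_mul a0 a2 (LthetaNorm_nonneg _ _) h0)
    (mul_nonneg (LthetaNorm_nonneg _ _) (LthetaNorm_nonneg _ _)) (by positivity))
  have : 2 / (((j + 1 : ℕ) : ℝ) / M) ≤ 2 * M := by
    rw [div_div_eq_mul_div]
    refine div_le_self (by positivity) ?_
    push_cast
    linarith [(Nat.cast_nonneg j : (0 : ℝ) ≤ j)]
  linarith

/-- Hölder's inequality for the `L²` norm of a product. -/
theorem L2norm_prod_le {D : ℕ} {κ : Type*} [Fintype κ] {g : κ → (Fin D → ℝ) → ℝ}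
    (hc : ∀ i, Continuous (g i)) (hg : ∀ i, TorusFun D (g i)) {θ : κ → ℝ}
    (hθ : ∀ i, 0 ≤ θ i) (hsum : ∑ i, θ i = 1) :
    L2norm (fun x => ∏ i, g i x) ≤ ∏ i, LthetaNorm (θ i) (g i) := by
  refine Real.sqrt_le_iff.2 ⟨Finset.prod_nonneg fun i _ => LthetaNorm_nonneg _ _, ?_⟩
  have h := integral_prod_abs_rpow_le Finset.univ (fun i _ => hc i) (fun i _ => hg i)
    (a := fun _ => 2) (fun i _ => hθ i) (fun _ _ => zero_le_two)
    (by rw [← Finset.mul_sum, hsum, mul_one])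
  simpa only [L2sq, Real.rpow_two, sq_abs, Finset.prod_pow] using h

theorem prod_pow_mul_prod_erase_pow {κ : Type*} [Fintype κ] [DecidableEq κ] (H L : κ → ℝ)
    (n : κ → ℕ) :
    ∏ r, L r ^ (∑ s, n s - n r) * H r ^ n r =
      ∏ r, (H r * ∏ s ∈ Finset.univ.erase r, L s) ^ n r := by
  simp only [mul_pow, Finset.prod_mul_distrib, ← Finset.prod_pow]
  rw [mul_comm]
  congr 1
  rw [Finset.prod_comm' (t' := Finset.univ) (s' := fun s => Finset.univ.erase s)
    (by simp [eq_comm])]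
  refine Finset.prod_congr rfl fun s _ => ?_
  rw [Finset.prod_pow_eq_pow_sum, ← Finset.add_sum_erase _ n (Finset.mem_univ s),
    Nat.add_sub_cancel_left]

/-- **Sobolev product inequality on the torus** (paper's Lemma 4.1, inequality (4.3)):
there is `C = C(D, M₁, R) > 0` such that for all spatial multi-indices `ι_1, …, ι_R` with
`Σ_r |ι_r| = M₁` and all smooth periodic functions `v_1, …, v_R`,
`‖∂^{ι_1} v_1 ⋯ ∂^{ι_R} v_R‖_{L²} ≤ C Σ_r ‖v_r‖_{Ḣ^{M₁}} ∏_{s ≠ r} ‖v_s‖_{L^∞}`. -/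
theorem stmt2 (D R M₁ : ℕ) (hD : 1 ≤ D) (hR : 1 ≤ R) :
    ∃ C : ℝ, 0 < C ∧ ∀ ι : Fin R → List (Fin D), (∑ r, (ι r).length) = M₁ →
      ∀ v : Fin R → (Fin D → ℝ) → ℝ,
        (∀ r, ContDiff ℝ (⊤ : ℕ∞) (v r)) → (∀ r, TorusFun D (v r)) →
        L2norm (fun x => ∏ r, pdIter (ι r) (v r) x) ≤
          C * ∑ r, HdotNorm M₁ (v r) * ∏ s ∈ Finset.univ.erase r, LinfNorm (v s) := by
  obtain ⟨C, hC, hint⟩ := exists_interpolation_const (2 * M₁ + 1) (by simp) M₁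
  have hCR : 1 ≤ C ^ R := one_le_pow₀ hC
  refine ⟨C ^ R, by positivity, fun ι hι v hv hp => ?_⟩
  have hcont : ∀ r, Continuous (pdIter (ι r) (v r)) := fun r =>
    (contDiff_pdIter (hv r) (ι r)).continuous
  have hper : ∀ r, TorusFun D (pdIter (ι r) (v r)) := fun r => (hp r).pdIter (ι r)
  have hL : ∀ r, 0 ≤ LinfNorm (v r) := fun r => LinfNorm_nonneg _
  have hH : ∀ r, 0 ≤ HdotNorm M₁ (v r) := fun r => Real.sqrt_nonneg _
  have hz : ∀ r, 0 ≤ HdotNorm M₁ (v r) * ∏ s ∈ Finset.univ.erase r, LinfNorm (v s) :=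
    fun r => mul_nonneg (hH r) (Finset.prod_nonneg fun s _ => hL s)
  have hle : ∀ r, HdotNorm M₁ (v r) * ∏ s ∈ Finset.univ.erase r, LinfNorm (v s) ≤
      ∑ r, HdotNorm M₁ (v r) * ∏ s ∈ Finset.univ.erase r, LinfNorm (v s) := fun r =>
    Finset.single_le_sum (fun r _ => hz r) (Finset.mem_univ r)
  set S := ∑ r, HdotNorm M₁ (v r) * ∏ s ∈ Finset.univ.erase r, LinfNorm (v s) with hS
  have hS0 : 0 ≤ S := Finset.sum_nonneg fun r _ => hz r
  rcases Nat.eq_zero_or_pos M₁ with rfl | hM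
  · have hnil : ∀ r, ι r = [] := fun r =>
      List.length_eq_zero_iff.1 ((Finset.sum_eq_zero_iff.1 hι) r (Finset.mem_univ r))
    let r₀ : Fin R := ⟨0, hR⟩
    have h := L2norm_prod_le hcont hper (θ := fun r => if r = r₀ then 1 else 0)
      (fun r => by positivity) (by simp)
    refine (h.trans (le_of_eq ?_)).trans ((hle r₀).trans (le_mul_of_one_le_left hS0 hCR))
    rw [← Finset.mul_prod_erase _ _ (Finset.mem_univ r₀)]
    congr 1
    · simp [hnil, LthetaNorm_one, HdotNorm, L2norm, pdIter]
    · refine Finset.prod_congr rfl fun s hs => ?_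
      rw [if_neg (Finset.ne_of_mem_erase hs), LthetaNorm_zero, hnil]
      rfl
  · have hM' : (M₁ : ℝ) ≠ 0 := by exact_mod_cast hM.ne'
    have h := L2norm_prod_le hcont hper (θ := fun r => ((ι r).length : ℝ) / M₁)
      (fun r => by positivity)
      (by rw [← Finset.sum_div, ← Nat.cast_sum, hι, div_self hM'])
    refine h.trans ?_
    refine le_of_pow_le_pow_left₀ hM.ne' (by positivity) ?_
    have hle_M : ∀ r, (ι r).length ≤ M₁ := fun r => by
      rw [← hι]
      exact Finset.single_le_sum (f := fun r => (ι r).length) (fun _ _ => Nat.zero_le _)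
        (Finset.mem_univ r)
    have hfac : ∀ r, LthetaNorm (((ι r).length : ℝ) / M₁) (pdIter (ι r) (v r)) ^ M₁ ≤
        C * (LinfNorm (v r) ^ (M₁ - (ι r).length) * HdotNorm M₁ (v r) ^ (ι r).length) := by
      intro r
      have h1 := hint (ι r).length (hle_M r) (maxDerivNorm M₁ (v r))
        (maxDerivNorm_nonneg M₁ (v r)) fun i hi =>
          (sq_maxDerivNorm_le (hv r) (hp r) hi).trans
            (mul_le_mul_of_nonneg_right (by linarith)
              (mul_nonneg (maxDerivNorm_nonneg _ _ _) (maxDerivNorm_nonneg _ _ _)))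
      rw [maxDerivNorm_zero] at h1
      refine (pow_le_pow_left₀ (LthetaNorm_nonneg _ _)
        (LthetaNorm_le_maxDerivNorm M₁ (v r) (ι r)) M₁).trans (h1.trans ?_)
      have := hL r
      have := maxDerivNorm_nonneg M₁ (v r) M₁
      have := maxDerivNorm_self_le hM.ne' (v r)
      gcongr
    calc (∏ r, LthetaNorm (((ι r).length : ℝ) / M₁) (pdIter (ι r) (v r))) ^ M₁
        = ∏ r, LthetaNorm (((ι r).length : ℝ) / M₁) (pdIter (ι r) (v r)) ^ M₁ :=
          (Finset.prod_pow _ _ _).symm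
      _ ≤ ∏ r, C * (LinfNorm (v r) ^ (M₁ - (ι r).length) *
            HdotNorm M₁ (v r) ^ (ι r).length) :=
          Finset.prod_le_prod (fun r _ => pow_nonneg (LthetaNorm_nonneg _ _) _)
            fun r _ => hfac r
      _ = C ^ R * ∏ r, (HdotNorm M₁ (v r) *
            ∏ s ∈ Finset.univ.erase r, LinfNorm (v s)) ^ (ι r).length := by
          rw [Finset.prod_mul_distrib, ← prod_pow_mul_prod_erase_pow, hι]
          simp
      _ ≤ C ^ R * ∏ r, S ^ (ι r).length :=
          mul_le_mul_of_nonneg_left (Finset.prod_le_prod (fun r _ => pow_nonneg (hz r) _)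
            fun r _ => pow_le_pow_left₀ (hz r) (hle r) _) (by positivity)
      _ = C ^ R * S ^ M₁ := by rw [Finset.prod_pow_eq_pow_sum, hι]
      _ ≤ (C ^ R) ^ M₁ * S ^ M₁ :=
          mul_le_mul_of_nonneg_right (le_self_pow₀ hCR hM.ne') (by positivity)
      _ = (C ^ R * S) ^ M₁ := (mul_pow _ _ _).symm
end
end

section
/- Let D ≥ 3, B̃ ∈ ℝ, and let q̃_1, …, q̃_D ∈ ℝ satisfy the Kasner constraints Σ_{I=1}^D q̃_I = 1 and Σ_{I=1}^D q̃_I² = 1 − B̃², and assume the configuration is not the trivial case. Then the sub-criticality condition max{ q̃_I + q̃_J − q̃_B : 1 ≤ I < J ≤ D, 1 ≤ B ≤ D } < 1 holds if and only if max{ q̃_I + q̃_J − q̃_B : I, J, B ∈ {1,…,D} pairwise distinct } < 1. (Paper's Remark 1.1, second assertion: equivalence of conditions (1.3) and (1.4).) -/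
/-- Numbers with sum `1` and sum of squares at most `1` are all less than `1`, unless one of them
is `1` and the others vanish. -/
theorem lt_one_of_sum_eq_one_of_sum_sq_le_one {ι : Type*} [Fintype ι] (q : ι → ℝ)
    (h1 : ∑ i, q i = 1) (h2 : ∑ i, q i ^ 2 ≤ 1)
    (hnontriv : ¬ ∃ j, q j = 1 ∧ ∀ i, i ≠ j → q i = 0) (j : ι) : q j < 1 := by
  classical
  by_contra! hj
  have hsplit := Finset.add_sum_erase Finset.univ (fun i => q i ^ 2) (Finset.mem_univ j)
  have hzero : ∀ i, i ≠ j → q i = 0 := by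
    intro i hi
    have hle : q i ^ 2 ≤ ∑ k ∈ Finset.univ.erase j, q k ^ 2 :=
      Finset.single_le_sum (f := fun k => q k ^ 2) (fun k _ => sq_nonneg (q k))
        (Finset.mem_erase.2 ⟨hi, Finset.mem_univ i⟩)
    exact pow_eq_zero_iff two_ne_zero |>.1 (by nlinarith [sq_nonneg (q i)])
  refine hnontriv ⟨j, ?_, hzero⟩
  rw [← h1, Fintype.sum_eq_single j hzero]


/-- **Equivalence of the two forms of the sub-criticality condition** (paper's Remark 1.1,
second assertion: equivalence of conditions (1.3) and (1.4)) for non-trivial generalized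
Kasner exponents satisfying the Kasner constraints. -/
theorem stmt7 (D : ℕ) (hD : 3 ≤ D) (q : Fin D → ℝ) (B : ℝ)
    (h1 : ∑ I, q I = 1) (h2 : ∑ I, q I ^ 2 = 1 - B ^ 2)
    (hnontriv : ¬ ∃ J, q J = 1 ∧ ∀ I, I ≠ J → q I = 0) :
    (∀ I J B' : Fin D, I < J → q I + q J - q B' < 1) ↔
      (∀ I J B' : Fin D, I ≠ J → J ≠ B' → I ≠ B' → q I + q J - q B' < 1) := by
  have hlt := lt_one_of_sum_eq_one_of_sum_sq_le_one q h1
    (by rw [h2]; linarith [sq_nonneg B]) hnontriv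
  constructor
  · intro h I J B' hIJ _ _
    rcases hIJ.lt_or_gt with hlt' | hgt
    · exact h I J B' hlt'
    · linarith [h J I B' hgt]
  · intro h I J B' hIJ
    by_cases hI : I = B'
    · subst hI
      linarith [hlt J]
    by_cases hJ : J = B'
    · subst hJ
      linarith [hlt I]
    exact h I J B' hIJ.ne hJ hI
end

section
/- For every integer D ≥ 10 there exist real numbers q̃_1, …, q̃_D with Σ_{I=1}^D q̃_I = 1, Σ_{I=1}^D q̃_I² = 1, and max{ q̃_I + q̃_J − q̃_B : 1 ≤ I < J ≤ D, 1 ≤ B ≤ D } < 1; that is, the set of sub-critical vacuum Kasner exponents is non-empty in every spatial dimension D ≥ 10. -/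
/-- A two-valued solution of the vacuum Kasner constraints, with value `-a` taken `3` times and
value `b` taken `m` times, satisfying the sub-criticality condition. -/
theorem exists_two_valued_kasner {m : ℝ} (hm : 7 ≤ m) :
    ∃ a b : ℝ, 0 < a ∧ 0 < b ∧ m * b - 3 * a = 1 ∧ m * b ^ 2 + 3 * a ^ 2 = 1 ∧
      2 * b + a < 1 := by
  have hc : 0 ≤ (m - 2) / (m + 6) := div_nonneg (by linarith) (by linarith)
  have hpos : 0 < (9 + 3 * m) * ((m - 2) / (m + 6)) ^ 2 + 6 * ((m - 2) / (m + 6)) + 1 - m := by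
    have key : (9 + 3 * m) * ((m - 2) / (m + 6)) ^ 2 + 6 * ((m - 2) / (m + 6)) + 1 - m =
        2 * m * (m - 6) * (m + 2) / (m + 6) ^ 2 := by
      have : m + 6 ≠ 0 := by linarith
      field_simp
      ring
    rw [key]
    have : 0 < m - 6 := by linarith
    positivity
  obtain ⟨a, ⟨ha0, hac⟩, ha⟩ :=
    intermediate_value_Ioo (f := fun x : ℝ => (9 + 3 * m) * x ^ 2 + 6 * x + 1 - m) hc
      (by fun_prop) ⟨by norm_num; linarith, hpos⟩
  have ha' : (9 + 3 * m) * a ^ 2 + 6 * a + 1 - m = 0 := ha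
  have hm0 : 0 < m := by linarith
  refine ⟨a, (1 + 3 * a) / m, ha0, by positivity, ?_, ?_, ?_⟩
  · field_simp
    ring
  · field_simp
    linarith
  · rw [lt_div_iff₀ (by linarith)] at hac
    have : 2 * ((1 + 3 * a) / m) + a = (2 + 6 * a + a * m) / m := by
      field_simp
      ring
    rw [this, div_lt_one hm0]
    linarith

/-- **Non-emptiness of the sub-critical vacuum Kasner regime for `D ≥ 10`**: for every
spatial dimension `D ≥ 10` there exist vacuum Kasner exponents (`Σ q̃_I = 1`,
`Σ q̃_I² = 1`) satisfying the sub-criticality condition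
`max_{I<J, B} (q̃_I + q̃_J − q̃_B) < 1`. -/
theorem stmt10 (D : ℕ) (hD : 10 ≤ D) :
    ∃ q : Fin D → ℝ, (∑ I, q I = 1) ∧ (∑ I, q I ^ 2 = 1) ∧
      ∀ I J B : Fin D, I < J → q I + q J - q B < 1 := by
  obtain ⟨m, rfl⟩ := Nat.exists_eq_add_of_le (show 3 ≤ D by omega)
  have hm : (7 : ℝ) ≤ m := by exact_mod_cast (show 7 ≤ m by omega)
  obtain ⟨a, b, ha, hb, hsum, hsq, hlt⟩ := exists_two_valued_kasner hm
  let q : Fin (3 + m) → ℝ := Fin.append (fun _ => -a) (fun _ => b)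
  have hq : ∀ I, -a ≤ q I ∧ q I ≤ b := by
    refine Fin.addCases (fun i => ?_) (fun i => ?_)
    · simp only [q, Fin.append_left]
      constructor <;> linarith
    · simp only [q, Fin.append_right]
      constructor <;> linarith
  refine ⟨q, ?_, ?_, fun I J B _ => ?_⟩
  · simp only [q, Fin.sum_univ_add, Fin.append_left, Fin.append_right, Finset.sum_const,
      Finset.card_univ, Fintype.card_fin, nsmul_eq_mul]
    push_cast
    linarith
  · simp only [q, Fin.sum_univ_add, Fin.append_left, Fin.append_right, Finset.sum_const,
      Finset.card_univ, Fintype.card_fin, nsmul_eq_mul]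
    push_cast
    linarith
  · linarith [(hq I).2, (hq J).2, (hq B).1]
end

section
/- Fix D ≥ 3 and real generalized Kasner exponents q̃_1, …, q̃_D. Suppose that on (0, 1] × 𝕋^D the reduced variables n > 0, e_I^i, k_{IJ}, γ_{IJB} are continuously differentiable, that k is symmetric (k_{IJ} = k_{JI}), that γ is antisymmetric in its last two indices (γ_{IJB} = −γ_{IBJ}), and that for all I, J, B the connection-coefficient evolution equation holds: e_0 γ_{IJB} = e_B k_{IJ} − e_J k_{BI} − k_{IC} γ_{BJC} − k_{CJ} γ_{BIC} + k_{IC} γ_{JBC} + k_{BC} γ_{JIC} + k_{IC} γ_{CJB} + n^{−1}(e_B n) k_{IJ} − n^{−1}(e_J n) k_{BI}, where e_0 := n^{−1} ∂_t. Then for all I, J, B the structure coefficients γ_{IJB} + γ_{JBI} satisfy the approximately diagonal evolution equation: ∂_t(γ_{IJB} + γ_{JBI}) + ((q̃_I + q̃_J − q̃_B)/t)(γ_{IJB} + γ_{JBI}) = (n−1){ k_{IC} γ_{CJB} − k_{CI} γ_{BJC} − k_{JC} γ_{BIC} + k_{CI} γ_{JBC} + k_{BC} γ_{JIC} } + (n−1){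 k_{JC} γ_{CBI} − k_{CJ} γ_{IBC} − k_{BC} γ_{IJC} + k_{CJ} γ_{BIC} + k_{IC} γ_{BJC} } + (k_{IC} − k̃_{IC}) γ_{CJB} − (k_{CI} − k̃_{CI}) γ_{BJC} − (k_{JC} − k̃_{JC}) γ_{BIC} + (k_{CI} − k̃_{CI}) γ_{JBC} + (k_{BC} − k̃_{BC}) γ_{JIC} + (k_{JC} − k̃_{JC}) γ_{CBI} − (k_{CJ} − k̃_{CJ}) γ_{IBC} − (k_{BC} − k̃_{BC}) γ_{IJC} + (k_{CJ} − k̃_{CJ}) γ_{BIC} + (k_{IC} − k̃_{IC}) γ_{BJC} + n (e_I^c − ẽ_I^c) ∂_c k_{BJ} − n (e_J^c − ẽ_J^c) ∂_c k_{BI} + n ẽ_I^c ∂_c k_{BJ} − n ẽ_J^c ∂_c k_{BI} + (e_I n) k_{BJ} − (e_J n) k_{BI}, where the free indices I, J, B are not summed in q̃_I + q̃_J − q̃_B, and k̃_{IJ} := −(q̃_I/t) δ_{IJ}, ẽ_I^i := t^{−q̃_I} δ_I^i. (Paper's Proposition 5.3, equation (5.15): the key diagonal evolution equation for the structure coefficients.)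 -/
noncomputable section

/-- `f(t,·)` is `ℤ^D`-periodic for every `t`: models a family of functions on `𝕋^D`. -/
def TorusFam (D : ℕ) (f : ℝ → (Fin D → ℝ) → ℝ) : Prop :=
  ∀ (t : ℝ) (x : Fin D → ℝ) (i : Fin D), f t (x + Pi.single i 1) = f t x

/-- Time derivative `∂_t f`. -/
def ptd {D : ℕ} (f : ℝ → (Fin D → ℝ) → ℝ) : ℝ → (Fin D → ℝ) → ℝ :=
  fun t x => deriv (fun s => f s x) t

/-- Spatial coordinate derivative `∂_i f`. -/
def pxd {D : ℕ} (i : Fin D) (f : ℝ → (Fin D → ℝ) → ℝ) : ℝ → (Fin D → ℝ) → ℝ :=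
  fun t x => fderiv ℝ (fun y => f t y) x (Pi.single i 1)

/-- Frame derivative `e_I f := e_I^c ∂_c f` (sum over the coordinate index `c`). -/
def eD {D : ℕ} (e : Fin D → Fin D → ℝ → (Fin D → ℝ) → ℝ) (I : Fin D)
    (f : ℝ → (Fin D → ℝ) → ℝ) : ℝ → (Fin D → ℝ) → ℝ :=
  fun t x => ∑ c : Fin D, e I c t x * pxd c f t x

/-- Normal derivative `e_0 f := n⁻¹ ∂_t f`. -/
def e0 {D : ℕ} (n : ℝ → (Fin D → ℝ) → ℝ) (f : ℝ → (Fin D → ℝ) → ℝ) :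
    ℝ → (Fin D → ℝ) → ℝ :=
  fun t x => (n t x)⁻¹ * ptd f t x

/-- Background Kasner lapse `ñ = 1`. -/
def kasN (D : ℕ) : ℝ → (Fin D → ℝ) → ℝ := fun _ _ => 1

/-- Background Kasner frame components `ẽ_I^i = t^{−q̃_I} δ_I^i` (Kronecker delta,
no summation over `I`). -/
def kasE {D : ℕ} (q : Fin D → ℝ) (I i : Fin D) : ℝ → (Fin D → ℝ) → ℝ :=
  fun t _ => if I = i then t ^ (-(q I)) else 0

/-- Background Kasner co-frame components `ω̃_i^I = t^{q̃_I} δ_i^I`. -/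
def kasOm {D : ℕ} (q : Fin D → ℝ) (I i : Fin D) : ℝ → (Fin D → ℝ) → ℝ :=
  fun t _ => if I = i then t ^ (q I) else 0

/-- Background Kasner second fundamental form components `k̃_{IJ} = −(q̃_I/t) δ_{IJ}`. -/
def kasK {D : ℕ} (q : Fin D → ℝ) (I J : Fin D) : ℝ → (Fin D → ℝ) → ℝ :=
  fun t _ => if I = J then -(q I) / t else 0

/-- Background Kasner connection coefficients `γ̃_{IJB} = 0`. -/
def kasGam {D : ℕ} (_I _J _B : Fin D) : ℝ → (Fin D → ℝ) → ℝ := fun _ _ => 0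

/-- Background Kasner scalar field `ψ̃ = B̃ log t`. -/
def kasPsi (D : ℕ) (B : ℝ) : ℝ → (Fin D → ℝ) → ℝ := fun t _ => B * Real.log t

/-- `f` is continuously differentiable on `(0,1] × 𝕋^D`: at every point of the domain it is
differentiable in `t` and in `x`, with the (total) derivative data used in the equations. -/
def C1on {D : ℕ} (f : ℝ → (Fin D → ℝ) → ℝ) : Prop :=
  ∀ (x : Fin D → ℝ), ∀ t ∈ Set.Ioc (0 : ℝ) 1,
    DifferentiableAt ℝ (fun s => f s x) t ∧ DifferentiableAt ℝ (fun y => f t y) x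

/-- Contracting against `k − k̃` on its second index subtracts the single diagonal background term. -/
theorem sum_kasK_left {D : ℕ} (q : Fin D → ℝ) (I : Fin D) (t : ℝ) (x : Fin D → ℝ)
    (k g : Fin D → ℝ) :
    ∑ C : Fin D, (k C - kasK q I C t x) * g C = (∑ C : Fin D, k C * g C) + q I / t * g I := by
  simp [kasK, sub_mul, Finset.sum_sub_distrib, neg_div]

/-- Contracting against `k − k̃` on its first index subtracts the single diagonal background term. -/
theorem sum_kasK_right {D : ℕ} (q : Fin D → ℝ) (I : Fin D) (t : ℝ) (x : Fin D → ℝ)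
    (k g : Fin D → ℝ) :
    ∑ C : Fin D, (k C - kasK q C I t x) * g C = (∑ C : Fin D, k C * g C) + q I / t * g I := by
  simp [kasK, sub_mul, Finset.sum_sub_distrib, neg_div]

/-- **The key approximately diagonal evolution equations for the structure coefficients**
(paper's Proposition 5.3, equation (5.15)): if `k` is symmetric, `γ` is antisymmetric in
its last two indices, and the connection-coefficient evolution equation (the paper's
(5.13)) holds, then the structure coefficients `γ_{IJB} + γ_{JBI}` satisfy the stated
evolution equation whose diagonal coefficient is `(q̃_I + q̃_J − q̃_B)/t`. Repeated capital
indices `C` and coordinate indices `c` are summed from `1` to `D`. -/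
theorem stmt15 (D : ℕ) (hD : 3 ≤ D) (q : Fin D → ℝ)
    (n : ℝ → (Fin D → ℝ) → ℝ)
    (e : Fin D → Fin D → ℝ → (Fin D → ℝ) → ℝ)
    (k : Fin D → Fin D → ℝ → (Fin D → ℝ) → ℝ)
    (γ : Fin D → Fin D → Fin D → ℝ → (Fin D → ℝ) → ℝ)
    -- the variables live on (0,1] × 𝕋^D
    (hnP : TorusFam D n) (heP : ∀ I i, TorusFam D (e I i))
    (hkP : ∀ I J, TorusFam D (k I J)) (hγP : ∀ I J B, TorusFam D (γ I J B))
    -- positivity of the lapse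
    (hnpos : ∀ t ∈ Set.Ioc (0 : ℝ) 1, ∀ x, 0 < n t x)
    -- continuous differentiability of the reduced variables
    (hnC1 : C1on n) (heC1 : ∀ I i, C1on (e I i))
    (hkC1 : ∀ I J, C1on (k I J)) (hγC1 : ∀ I J B, C1on (γ I J B))
    -- symmetry of k and antisymmetry of γ in its last two indices
    (hksym : ∀ I J t x, k I J t x = k J I t x)
    (hγanti : ∀ I J B t x, γ I J B t x = -γ I B J t x)
    -- the connection-coefficient evolution equation (paper's (5.13))
    (hevol : ∀ I J B, ∀ t ∈ Set.Ioc (0 : ℝ) 1, ∀ x,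
      e0 n (γ I J B) t x =
        eD e B (k I J) t x - eD e J (k B I) t x
        - (∑ C : Fin D, k I C t x * γ B J C t x)
        - (∑ C : Fin D, k C J t x * γ B I C t x)
        + (∑ C : Fin D, k I C t x * γ J B C t x)
        + (∑ C : Fin D, k B C t x * γ J I C t x)
        + (∑ C : Fin D, k I C t x * γ C J B t x)
        + (n t x)⁻¹ * eD e B n t x * k I J t x
        - (n t x)⁻¹ * eD e J n t x * k B I t x) :
    -- conclusion: the structure-coefficient evolution equation (paper's (5.15))
    ∀ I J B, ∀ t ∈ Set.Ioc (0 : ℝ) 1, ∀ x,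
      deriv (fun s => γ I J B s x + γ J B I s x) t
          + ((q I + q J - q B) / t) * (γ I J B t x + γ J B I t x) =
        (n t x - 1) *
            ((∑ C : Fin D, k I C t x * γ C J B t x)
              - (∑ C : Fin D, k C I t x * γ B J C t x)
              - (∑ C : Fin D, k J C t x * γ B I C t x)
              + (∑ C : Fin D, k C I t x * γ J B C t x)
              + (∑ C : Fin D, k B C t x * γ J I C t x))
        + (n t x - 1) *
            ((∑ C : Fin D, k J C t x * γ C B I t x)
              - (∑ C : Fin D, k C J t x * γ I B C t x)
              - (∑ C : Fin D, k B C t x * γ I J C t x)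
              + (∑ C : Fin D, k C J t x * γ B I C t x)
              + (∑ C : Fin D, k I C t x * γ B J C t x))
        + (∑ C : Fin D, (k I C t x - kasK q I C t x) * γ C J B t x)
        - (∑ C : Fin D, (k C I t x - kasK q C I t x) * γ B J C t x)
        - (∑ C : Fin D, (k J C t x - kasK q J C t x) * γ B I C t x)
        + (∑ C : Fin D, (k C I t x - kasK q C I t x) * γ J B C t x)
        + (∑ C : Fin D, (k B C t x - kasK q B C t x) * γ J I C t x)
        + (∑ C : Fin D, (k J C t x - kasK q J C t x) * γ C B I t x)
        - (∑ C : Fin D, (k C J t x - kasK q C J t x) * γ I B C t x)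
        - (∑ C : Fin D, (k B C t x - kasK q B C t x) * γ I J C t x)
        + (∑ C : Fin D, (k C J t x - kasK q C J t x) * γ B I C t x)
        + (∑ C : Fin D, (k I C t x - kasK q I C t x) * γ B J C t x)
        + n t x * (∑ c : Fin D, (e I c t x - kasE q I c t x) * pxd c (k B J) t x)
        - n t x * (∑ c : Fin D, (e J c t x - kasE q J c t x) * pxd c (k B I) t x)
        + n t x * (∑ c : Fin D, kasE q I c t x * pxd c (k B J) t x)
        - n t x * (∑ c : Fin D, kasE q J c t x * pxd c (k B I) t x)
        + eD e I n t x * k B J t x - eD e J n t x * k B I t x := by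
  intro I J B t ht x
  have hn : n t x ≠ 0 := (hnpos t ht x).ne'
  have hkBJ : k B J = k J B := by funext s y; exact hksym B J s y
  have hksymC_sum (A : Fin D) (g : Fin D → ℝ) :
      ∑ C : Fin D, k C A t x * g C = ∑ C : Fin D, k A C t x * g C := by
    simp only [hksym _ A t x]
  have hderiv : deriv (fun s => γ I J B s x + γ J B I s x) t
      = n t x * e0 n (γ I J B) t x + n t x * e0 n (γ J B I) t x := by
    simp only [e0, ptd, mul_inv_cancel_left₀ hn]
    exact deriv_fun_add (hγC1 I J B x t ht).1 (hγC1 J B I x t ht).1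
  -- The summand splits into `eD` and its background part, which then cancels.
  have hframe (A : Fin D) (f : ℝ → (Fin D → ℝ) → ℝ) :
      ∑ c : Fin D, (e A c t x - kasE q A c t x) * pxd c f t x
        = eD e A f t x - ∑ c : Fin D, kasE q A c t x * pxd c f t x := by
    simp only [eD, sub_mul, Finset.sum_sub_distrib]
  rw [hderiv, hevol I J B t ht x, hevol J B I t ht x]
  simp only [sum_kasK_left, sum_kasK_right, hframe, hkBJ]
  simp only [hksymC_sum I, hksymC_sum J, hksymC_sum B]
  rw [hγanti J I B t x, hγanti I B J t x]
  field_simp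
  ring
end
end
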